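/- Let n ≥ 1, let s_1, …, s_n, s_{n+1} ∈ ℝ, and let α ∈ (0,1). Set î = ⌈(1−α)(n+1)⌉ and let Q̂ be the î-th smallest element of the multiset {s_1, …, s_n} ∪ {+∞} in [−∞,+∞]. Then (1 + #{i ∈ {1,…,n} : s_i ≥ s_{n+1}})/(n+1) ≤ α if and only if s_{n+1} > Q̂. -/

import Mathlib

/-- The `k`-th smallest element (1-indexed) of a finite multiset of extended reals,
i.e. the `k`-th entry when the elements are listed in nondecreasing order
(counted with multiplicity). -/
noncomputable def kthSmallestE (A : Multiset EReal) (k : ℕ) : EReal :=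
  (A.sort (· ≤ ·)).getD (k - 1) 0

theorem List.Pairwise.getElem_lt_iff_lt_countP {β : Type*} [LinearOrder β] {l : List β}
    (hl : l.Pairwise (· ≤ ·)) (t : β) (j : ℕ) (hj : j < l.length) :
    l[j] < t ↔ j < l.countP (· < t) := by
  induction l generalizing j with
  | nil => simp at hj
  | cons a l ih =>
    rw [List.pairwise_cons] at hl
    by_cases ha : a < t
    · cases j with
      | zero => simp [ha]
      | succ j => simpa [ha] using ih hl.2 j (by simpa using hj)
    · have hmem : ∀ b ∈ a :: l, ¬ b < t := by
        intro b hb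
        rcases List.mem_cons.mp hb with rfl | hb
        · exact ha
        · exact fun h => ha ((hl.1 b hb).trans_lt h)
      have hcount : (a :: l).countP (· < t) = 0 := by
        rw [List.countP_eq_zero]
        simpa only [decide_eq_true_eq] using hmem
      rw [hcount]
      exact iff_of_false (hmem _ (List.getElem_mem hj)) (Nat.not_lt_zero j)

theorem kthSmallestE_lt_iff (A : Multiset EReal) (t : EReal) {k : ℕ} (hk : 1 ≤ k)
    (hkA : k ≤ A.card) : kthSmallestE A k < t ↔ k ≤ A.countP (· < t) := by
  have hlen : k - 1 < (A.sort (· ≤ ·)).length := by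
    rw [Multiset.length_sort]
    lia
  have hcount : A.countP (· < t) = (A.sort (· ≤ ·)).countP (· < t) := by
    conv_lhs => rw [← Multiset.sort_eq A (· ≤ ·)]
    exact Multiset.coe_countP _ _
  rw [kthSmallestE, List.getD_eq_getElem _ _ hlen,
    (Multiset.pairwise_sort A (· ≤ ·)).getElem_lt_iff_lt_countP t _ hlen, hcount]
  lia

/-- Proposition A.1.  For real scores `s 0, …, s n` (the first
`n` being calibration scores and `s (Fin.last n)` the test score) and
`Q̂` the `⌈(1−α)(n+1)⌉`-th smallest element of the calibration scores together
with `+∞`, the conformal p-value satisfies `p̂ ≤ α` iff `s (n+1) > Q̂`. -/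
theorem conformal_pvalue_iff_quantile
    (n : ℕ) (hn : 1 ≤ n) (s : Fin (n + 1) → ℝ)
    (α : ℝ) (hα : α ∈ Set.Ioo (0 : ℝ) 1) :
    (1 + ((Finset.univ.filter
        fun i : Fin n => s (Fin.last n) ≤ s i.castSucc).card : ℝ)) / (n + 1) ≤ α
      ↔ kthSmallestE
          ((⊤ : EReal) ::ₘ (Finset.univ.val.map
            fun i : Fin n => ((s i.castSucc : ℝ) : EReal)))
          ⌈(1 - α) * (n + 1)⌉₊
        < ((s (Fin.last n) : ℝ) : EReal) := by
  obtain ⟨hα0, hα1⟩ := hα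
  have hn1 : (0 : ℝ) < n + 1 := by positivity
  have hk : 1 ≤ ⌈(1 - α) * (n + 1)⌉₊ :=
    Nat.one_le_ceil_iff.mpr (mul_pos (sub_pos.mpr hα1) hn1)
  have hkn : ⌈(1 - α) * (n + 1)⌉₊ ≤ n + 1 := by
    rw [Nat.ceil_le]
    push_cast
    nlinarith
  rw [kthSmallestE_lt_iff _ _ hk (by simpa using hkn), Nat.ceil_le, div_le_iff₀ hn1]
  have hcount : Multiset.countP (· < ((s (Fin.last n) : ℝ) : EReal))
      ((⊤ : EReal) ::ₘ (Finset.univ.val.map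
        fun i : Fin n => ((s i.castSucc : ℝ) : EReal))) =
      (Finset.univ.filter fun i : Fin n => ¬ s (Fin.last n) ≤ s i.castSucc).card := by
    rw [Multiset.countP_cons_of_neg (p := (· < ((s (Fin.last n) : ℝ) : EReal))) _ not_top_lt,
       Multiset.countP_map]
    simp only [EReal.coe_lt_coe_iff, not_le]
    rfl
  have hsum := Finset.card_filter_add_card_filter_not (s := (Finset.univ : Finset (Fin n)))
    (fun i => s (Fin.last n) ≤ s i.castSucc)
  rw [Finset.card_univ, Fintype.card_fin, ← hcount] at hsum
  have hsum' : (_ : ℝ) = n := congrArg (Nat.cast (R := ℝ)) hsum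
  push_cast at hsum'
  constructor <;> intro h <;> linarith
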